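/- Assume X has a minimal subspace segmentation {X_1, …, X_K} with no pure segment such that no sample lies in S_k ∩ S_ℓ for k ≠ ℓ and {X_1, …, X_K} is intersected nondegenerately. If n_k > d_k + (K−1)d_0 for each k, and either d_1 = d_2 = … = d_K (when K > 2) or K = 2 (with d_1 and d_2 arbitrary), then the minimal partition J* = {J_1*, …, J_K*} is the single element of J(K, d, d_min). -/

import Mathlib

open Submodule Module Finset

noncomputable section

variable {m : ℕ} {ι : Type*}

/-- The subspace spanned by the subfamily of `x` indexed by `S`. -/
def spanOf (x : ι → EuclideanSpace ℝ (Fin m)) (S : Finset ι) :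
    Submodule ℝ (EuclideanSpace ℝ (Fin m)) :=
  Submodule.span ℝ (x '' (S : Set ι))

/-- The rank `r(X_S)` of the subfamily of `x` indexed by `S`. -/
def rOf (x : ι → EuclideanSpace ℝ (Fin m)) (S : Finset ι) : ℕ :=
  Module.finrank ℝ (spanOf x S)

/-- `X_S` is nondegenerate: every subfamily `X_T`, `T ⊆ S`, has rank `min |T| r(X_S)`. -/
def Nondeg (x : ι → EuclideanSpace ℝ (Fin m)) (S : Finset ι) : Prop :=
  ∀ T ⊆ S, rOf x T = min T.card (rOf x S)

/-- `span(X_S)` is a minimal sample subspace: `n(X_S) > r(X_S)` and `X_S` is nondegenerate. -/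
def IsMinimalSeg (x : ι → EuclideanSpace ℝ (Fin m)) (S : Finset ι) : Prop :=
  rOf x S < S.card ∧ Nondeg x S

/-- The component of `x i` in the orthogonal complement of `W ⊓ S'` within `W`. -/
def zComp (x : ι → EuclideanSpace ℝ (Fin m))
    (W S' : Submodule ℝ (EuclideanSpace ℝ (Fin m))) (i : ι) :
    EuclideanSpace ℝ (Fin m) :=
  (orthogonalProjection (W ⊓ (W ⊓ S')ᗮ) (x i) : EuclideanSpace ℝ (Fin m))

/-- The segmentation `{X_1, …, X_K}` is intersected nondegenerately: for every `k` and every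
subfamily indexed by `S` disjoint from `P k`, the family of components of the vectors of `X_k`
in the orthogonal complement (within `span(X_k)`) of `span(X_k) ⊓ span(X_S)` is zero or
nondegenerate. -/
def IntNondeg (x : ι → EuclideanSpace ℝ (Fin m)) {K : ℕ}
    (P : Fin K → Finset ι) : Prop :=
  ∀ (k : Fin K) (S : Finset ι), Disjoint S (P k) →
    (∀ i ∈ P k, zComp x (spanOf x (P k)) (spanOf x S) i = 0) ∨
      Nondeg (zComp x (spanOf x (P k)) (spanOf x S)) (P k)

/-- A minimal subspace segmentation of `X` with no pure segment, with index pieces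
`P 1, …, P K`. -/
structure IsMSSnp (x : ι → EuclideanSpace ℝ (Fin m)) {K : ℕ}
    (P : Fin K → Finset ι) : Prop where
  cover : ∀ i : ι, ∃ k, i ∈ P k
  disj : ∀ k ℓ, k ≠ ℓ → Disjoint (P k) (P ℓ)
  minimal : ∀ k, IsMinimalSeg x (P k)
  distinct : ∀ k ℓ, k ≠ ℓ → spanOf x (P k) ≠ spanOf x (P ℓ)

/-- The non-intersection condition for the minimal segments. -/
def NonIntersect (x : ι → EuclideanSpace ℝ (Fin m)) {K : ℕ}
    (P : Fin K → Finset ι) : Prop :=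
  ∀ (j : ι) (k ℓ : Fin K), k ≠ ℓ → x j ∉ spanOf x (P k) ⊓ spanOf x (P ℓ)

/-- The set `𝒥(K, d, dmin)`: partitions of the index set into `K` pieces, each of size
greater than `dmin`, whose segment ranks sum to at most `d`. -/
def InJSet (x : ι → EuclideanSpace ℝ (Fin m)) (K d dmin : ℕ)
    (Q : Fin K → Finset ι) : Prop :=
  (∀ i : ι, ∃ k, i ∈ Q k) ∧ (∀ k ℓ, k ≠ ℓ → Disjoint (Q k) (Q ℓ)) ∧
    (∀ k, dmin < (Q k).card) ∧ (∑ k, rOf x (Q k)) ≤ d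

section Span

variable (x : ι → EuclideanSpace ℝ (Fin m))

lemma spanOf_mono {S T : Finset ι} (h : S ⊆ T) : spanOf x S ≤ spanOf x T :=
  span_mono (Set.image_mono (by exact_mod_cast h))

lemma mem_spanOf {S : Finset ι} {i : ι} (h : i ∈ S) : x i ∈ spanOf x S :=
  subset_span ⟨i, by exact_mod_cast h, rfl⟩

lemma spanOf_le {S : Finset ι} {V : Submodule ℝ (EuclideanSpace ℝ (Fin m))} :
    spanOf x S ≤ V ↔ ∀ i ∈ S, x i ∈ V := by
  rw [spanOf, span_le]
  simp [Set.subset_def]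

lemma spanOf_union [DecidableEq ι] (S T : Finset ι) :
    spanOf x (S ∪ T) = spanOf x S ⊔ spanOf x T := by
  simp [spanOf, Set.image_union, span_union]

end Span

variable {x : ι → EuclideanSpace ℝ (Fin m)}

lemma sub_zComp_mem {W V : Submodule ℝ (EuclideanSpace ℝ (Fin m))} {i : ι} (hi : x i ∈ W) :
    x i - zComp x W V i ∈ W ⊓ V := by
  obtain ⟨u, hu, v, hv, huv⟩ := (W ⊓ V).exists_add_mem_mem_orthogonal (x i)
  have hvW : v ∈ W := by
    have : v = x i - u := by rw [huv]; abel
    rw [this]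
    exact W.sub_mem hi hu.1
  have hz : zComp x W V i = v := by
    have := Submodule.eq_starProjection_of_mem_orthogonal'
      (K := W ⊓ (W ⊓ V)ᗮ) (u := x i) (v := v) (z := u) ⟨hvW, hv⟩
      (fun w hw => inner_left_of_mem_orthogonal hu hw.2) (by rw [huv]; abel)
    rw [← this]
    rfl
  have : x i - zComp x W V i = u := by rw [hz, huv]; abel
  rwa [this]

lemma sup_spanOf_zComp {W V : Submodule ℝ (EuclideanSpace ℝ (Fin m))} {T : Finset ι}
    (hT : ∀ i ∈ T, x i ∈ W) : V ⊔ spanOf (zComp x W V) T = V ⊔ spanOf x T := by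
  have hV : ∀ i ∈ T, x i - zComp x W V i ∈ V := fun i hi => (sub_zComp_mem (hT i hi)).2
  refine le_antisymm (sup_le le_sup_left ?_) (sup_le le_sup_left ?_)
  · refine (spanOf_le _).2 fun i hi => ?_
    have := sub_mem (mem_sup_right (S := V) (mem_spanOf x hi)) (mem_sup_left (hV i hi))
    rwa [sub_sub_cancel] at this
  · refine (spanOf_le _).2 fun i hi => ?_
    have := add_mem (mem_sup_left (hV i hi)) (mem_sup_right (S := V)
      (mem_spanOf (zComp x W V) hi))
    rwa [sub_add_cancel] at this

lemma disjoint_spanOf_zComp (W V : Submodule ℝ (EuclideanSpace ℝ (Fin m))) (T : Finset ι) :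
    Disjoint V (spanOf (zComp x W V) T) := by
  have hle : spanOf (zComp x W V) T ≤ W ⊓ (W ⊓ V)ᗮ :=
    (spanOf_le _).2 fun i _ => Subtype.property _
  rw [Submodule.disjoint_def]
  intro v hv hvT
  have h := hle hvT
  exact inner_self_eq_zero.1 (inner_right_of_mem_orthogonal (K := W ⊓ V) ⟨h.1, hv⟩ h.2)

lemma finrank_sup_spanOf_or_le {K : ℕ} {P : Fin K → Finset ι} (hnd : IntNondeg x P) (k : Fin K)
    {S T : Finset ι} (hS : Disjoint S (P k)) (hT : T ⊆ P k) :
    finrank ℝ ↥(spanOf x S ⊔ spanOf x T) = rOf x S + T.card ∨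
      spanOf x (P k) ≤ spanOf x S ⊔ spanOf x T := by
  set W := spanOf x (P k)
  set V := spanOf x S with hV
  have hP : ∀ i ∈ P k, x i ∈ W := fun i hi => mem_spanOf x hi
  have eT := sup_spanOf_zComp (V := V) fun i hi => hP i (hT hi)
  have eP := sup_spanOf_zComp (V := V) hP
  rcases hnd k S hS with h0 | hz
  · right
    have : spanOf (zComp x W V) (P k) ≤ ⊥ := (spanOf_le _).2 fun i hi => h0 i hi
    rw [le_bot_iff.1 this, sup_bot_eq] at eP
    exact (le_sup_right.trans eP.ge).trans le_sup_left
  · have hr := hz T hT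
    rcases le_total T.card (rOf (zComp x W V) (P k)) with h | h
    · left
      rw [min_eq_left h] at hr
      have := finrank_sup_add_finrank_inf_eq V (spanOf (zComp x W V) T)
      rw [(disjoint_spanOf_zComp W V T).eq_bot, finrank_bot, eT] at this
      simpa [rOf, ← hV, ← hr] using this
    · right
      rw [min_eq_right h] at hr
      rw [← eT, eq_of_le_of_finrank_eq (spanOf_mono _ hT) hr, eP]
      exact le_sup_right

lemma rOf_eq_card_or_exists_le [DecidableEq ι] {K : ℕ} {P : Fin K → Finset ι}
    (hmss : IsMSSnp x P) (hnd : IntNondeg x P) (Q : Finset ι) :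
    rOf x Q = Q.card ∨ ∃ k, spanOf x (P k) ≤ spanOf x Q := by
  have key : ∀ s : Finset (Fin K),
      rOf x (s.biUnion fun k => Q ∩ P k) = (s.biUnion fun k => Q ∩ P k).card ∨
        ∃ k, spanOf x (P k) ≤ spanOf x (s.biUnion fun k => Q ∩ P k) := by
    intro s
    induction s using Finset.induction_on with
    | empty =>
      left
      rw [biUnion_empty, card_empty, rOf, spanOf, coe_empty, Set.image_empty, span_empty,
        finrank_bot]
    | insert k s hk ih =>
      have hdis : Disjoint (s.biUnion fun k => Q ∩ P k) (P k) := by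
        rw [disjoint_biUnion_left]
        intro l hl
        exact (hmss.disj l k (by rintro rfl; exact hk hl)).mono_left inter_subset_right
      rw [biUnion_insert, union_comm, card_union_of_disjoint (hdis.mono_right inter_subset_right),
        rOf, spanOf_union]
      rcases ih with ih | ⟨l, hl⟩
      · rw [← ih]
        exact (finrank_sup_spanOf_or_le hnd k hdis inter_subset_right).imp id fun h => ⟨k, h⟩
      · exact Or.inr ⟨l, hl.trans le_sup_left⟩
  have hQ : (univ.biUnion fun k => Q ∩ P k) = Q := by
    ext i
    simpa using fun _ => hmss.cover i
  simpa only [hQ] using key univ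

lemma notMem_spanOf {K : ℕ} {P : Fin K → Finset ι}
    (hmss : IsMSSnp x P) (hni : NonIntersect x P) {k : Fin K} {i : ι} (hi : i ∉ P k) :
    x i ∉ spanOf x (P k) := by
  obtain ⟨l, hl⟩ := hmss.cover i
  have hlk : l ≠ k := by rintro rfl; exact hi hl
  exact fun h => hni i l k hlk ⟨mem_spanOf x hl, h⟩

lemma subset_of_spanOf_le {K : ℕ} {P : Fin K → Finset ι}
    (hmss : IsMSSnp x P) (hni : NonIntersect x P) {k : Fin K} {Q : Finset ι}
    (hle : spanOf x (P k) ≤ spanOf x Q) (hr : rOf x Q ≤ rOf x (P k)) : Q ⊆ P k := by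
  intro i hi
  by_contra hik
  refine notMem_spanOf hmss hni hik ?_
  rw [eq_of_le_of_finrank_le hle hr]
  exact mem_spanOf x hi

lemma exists_equiv_of_spanOf_le {K : ℕ} {P Q : Fin K → Finset ι}
    (hmss : IsMSSnp x P) (hni : NonIntersect x P) (hQ : ∀ i, ∃ j, i ∈ Q j) (σ : Fin K → Fin K)
    (hle : ∀ j, spanOf x (P (σ j)) ≤ spanOf x (Q j))
    (hsum : ∑ j, rOf x (Q j) ≤ ∑ j, rOf x (P (σ j))) :
    ∃ e : Fin K ≃ Fin K, ∀ k, Q (e k) = P k := by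
  have hmono : ∀ j ∈ univ, rOf x (P (σ j)) ≤ rOf x (Q j) := fun j _ => finrank_mono (hle j)
  have heq := (sum_eq_sum_iff_of_le hmono).1 (le_antisymm (sum_le_sum hmono) hsum)
  have hsub : ∀ j, Q j ⊆ P (σ j) := fun j =>
    subset_of_spanOf_le hmss hni (hle j) (heq j (mem_univ j)).ge
  have hσ : ∀ {i j k}, i ∈ P k → i ∈ Q j → σ j = k := by
    intro i j k hk hj
    by_contra h
    exact Finset.disjoint_left.1 (hmss.disj _ _ h) (hsub j hj) hk
  have hsurj : Function.Surjective σ := by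
    intro k
    obtain ⟨i, hi⟩ := card_pos.1 ((Nat.zero_le _).trans_lt (hmss.minimal k).1)
    obtain ⟨j, hj⟩ := hQ i
    exact ⟨j, hσ hi hj⟩
  let e := Equiv.ofBijective σ (Finite.surjective_iff_bijective.1 hsurj)
  refine ⟨e.symm, fun k => Subset.antisymm ?_ fun i hi => ?_⟩
  · have : σ (e.symm k) = k := e.apply_symm_apply k
    simpa only [this] using hsub (e.symm k)
  · obtain ⟨j, hj⟩ := hQ i
    have : e.symm k = j := e.symm_apply_eq.2 (hσ hi hj).symm
    rwa [this]

lemma spanOf_le_or_rOf_eq_of_two [DecidableEq ι] {P : Fin 2 → Finset ι}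
    (hmss : IsMSSnp x P) (hnd : IntNondeg x P) {k l : Fin 2} (hkl : k ≠ l) {Q : Finset ι}
    (hle : spanOf x (P k) ≤ spanOf x Q) :
    spanOf x (P l) ≤ spanOf x Q ∨ rOf x Q = rOf x (P k) + (Q ∩ P l).card := by
  have hQ : spanOf x Q = spanOf x (P k) ⊔ spanOf x (Q ∩ P l) := by
    refine le_antisymm ?_ (sup_le hle (spanOf_mono x inter_subset_left))
    rw [← spanOf_union]
    refine spanOf_mono x fun i hi => ?_
    obtain ⟨j, hj⟩ := hmss.cover i
    have : j = k ∨ j = l := by omega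
    rcases this with rfl | rfl <;> simp [hi, hj]
  rw [rOf, hQ]
  exact (finrank_sup_spanOf_or_le hnd l (hmss.disj k l hkl) inter_subset_right).symm

lemma card_inter_add_card_inter_of_two [DecidableEq ι] {Q : Fin 2 → Finset ι}
    (hcov : ∀ i, ∃ j, i ∈ Q j) (hdis : ∀ j l, j ≠ l → Disjoint (Q j) (Q l)) (S : Finset ι) :
    (Q 0 ∩ S).card + (Q 1 ∩ S).card = S.card := by
  rw [← card_union_of_disjoint ((hdis 0 1 (by decide)).mono inter_subset_left inter_subset_left),
    ← union_inter_distrib_right, inter_eq_right.2]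
  intro i _
  obtain ⟨j, hj⟩ := hcov i
  fin_cases j <;> simp_all

lemma exists_equiv_of_two [DecidableEq ι] {P Q : Fin 2 → Finset ι}
    (hmss : IsMSSnp x P) (hni : NonIntersect x P) (hnd : IntNondeg x P) {c : ℕ}
    (hc : ∃ k, rOf x (P k) ≤ c) (hQ : InJSet x 2 (∑ k, rOf x (P k)) c Q) :
    ∃ e : Fin 2 ≃ Fin 2, ∀ k, Q (e k) = P k := by
  obtain ⟨hcov, hdis, hcard, hsum⟩ := hQ
  by_cases hσ : (spanOf x (P 0) ≤ spanOf x (Q 0) ∧ spanOf x (P 1) ≤ spanOf x (Q 1)) ∨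
      (spanOf x (P 1) ≤ spanOf x (Q 0) ∧ spanOf x (P 0) ≤ spanOf x (Q 1))
  · rcases hσ with h | h
    · exact exists_equiv_of_spanOf_le hmss hni hcov id (Fin.forall_fin_two.2 h) hsum
    · refine exists_equiv_of_spanOf_le hmss hni hcov (Equiv.swap 0 1)
        (Fin.forall_fin_two.2 (by simpa using h)) (hsum.trans ?_)
      simp [add_comm]
  exfalso
  have hinf : finrank ℝ ↥(spanOf x (P 0) ⊓ spanOf x (P 1)) ≤ c := by
    obtain ⟨k, hk⟩ := hc
    refine le_trans (finrank_mono ?_) hk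
    fin_cases k
    exacts [inf_le_left, inf_le_right]
  have hsup := finrank_sup_add_finrank_inf_eq (spanOf x (P 0)) (spanOf x (P 1))
  have hboth : ∀ j, spanOf x (P 0) ≤ spanOf x (Q j) → spanOf x (P 1) ≤ spanOf x (Q j) →
      finrank ℝ ↥(spanOf x (P 0) ⊔ spanOf x (P 1)) ≤ rOf x (Q j) :=
    fun j h₀ h₁ => finrank_mono (sup_le h₀ h₁)
  have hcase : ∀ j, rOf x (Q j) = (Q j).card ∨
      spanOf x (P 0) ≤ spanOf x (Q j) ∧ spanOf x (P 1) ≤ spanOf x (Q j) ∨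
      spanOf x (P 0) ≤ spanOf x (Q j) ∧ rOf x (Q j) = rOf x (P 0) + (Q j ∩ P 1).card ∨
      spanOf x (P 1) ≤ spanOf x (Q j) ∧ rOf x (Q j) = rOf x (P 1) + (Q j ∩ P 0).card := by
    intro j
    rcases rOf_eq_card_or_exists_le hmss hnd (Q j) with h | h
    · exact Or.inl h
    rcases Fin.exists_fin_two.1 h with h | h
    · rcases spanOf_le_or_rOf_eq_of_two hmss hnd (l := 1) (by decide) h with g | g
      · exact Or.inr (Or.inl ⟨h, g⟩)
      · exact Or.inr (Or.inr (Or.inl ⟨h, g⟩))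
    · rcases spanOf_le_or_rOf_eq_of_two hmss hnd (l := 0) (by decide) h with g | g
      · exact Or.inr (Or.inl ⟨g, h⟩)
      · exact Or.inr (Or.inr (Or.inr ⟨h, g⟩))
  have hP₀ := card_inter_add_card_inter_of_two hcov hdis (P 0)
  have hP₁ := card_inter_add_card_inter_of_two hcov hdis (P 1)
  have hQ₀ := card_inter_add_card_inter_of_two hmss.cover hmss.disj (Q 0)
  have hQ₁ := card_inter_add_card_inter_of_two hmss.cover hmss.disj (Q 1)
  simp only [inter_comm (P _) (Q _)] at hQ₀ hQ₁
  have hn₀ := (hmss.minimal 0).1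
  have hn₁ := (hmss.minimal 1).1
  have hc₀ := hcard 0
  have hc₁ := hcard 1
  have hb₀ := hboth 0
  have hb₁ := hboth 1
  have hq₀ := hcase 0
  have hq₁ := hcase 1
  rw [Fin.sum_univ_two, Fin.sum_univ_two] at hsum
  change _ = rOf x (P 0) + rOf x (P 1) at hsup
  clear hboth hcase
  generalize (spanOf x (P 0) ≤ spanOf x (Q 0)) = p₀₀ at *
  generalize (spanOf x (P 0) ≤ spanOf x (Q 1)) = p₀₁ at *
  generalize (spanOf x (P 1) ≤ spanOf x (Q 0)) = p₁₀ at *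
  generalize (spanOf x (P 1) ≤ spanOf x (Q 1)) = p₁₁ at *
  grind

lemma exists_equiv_of_rOf_eq [DecidableEq ι] {K : ℕ} {P Q : Fin K → Finset ι}
    (hmss : IsMSSnp x P) (hni : NonIntersect x P) (hnd : IntNondeg x P) {c : ℕ}
    (hc : ∀ k, rOf x (P k) = c) (hQ : InJSet x K (∑ k, rOf x (P k)) c Q) :
    ∃ e : Fin K ≃ Fin K, ∀ k, Q (e k) = P k := by
  obtain ⟨hcov, -, hcard, hsum⟩ := hQ
  have hge : ∀ j ∈ univ, c ≤ rOf x (Q j) := by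
    intro j _
    rcases rOf_eq_card_or_exists_le hmss hnd (Q j) with h | ⟨k, hk⟩
    · exact h ▸ (hcard j).le
    · exact hc k ▸ finrank_mono hk
  simp only [hc] at hsum
  have heq := (sum_eq_sum_iff_of_le hge).1 (le_antisymm (sum_le_sum hge) hsum)
  have hex : ∀ j, ∃ k, spanOf x (P k) ≤ spanOf x (Q j) := by
    intro j
    refine (rOf_eq_card_or_exists_le hmss hnd (Q j)).resolve_left fun h => ?_
    exact (hcard j).ne ((heq j (mem_univ j)).trans h)
  choose σ hσ using hex
  exact exists_equiv_of_spanOf_le hmss hni hcov σ hσ (by simpa only [hc] using hsum)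

/-- If `n_k > d_k + (K−1)·d_0` for each `k`, and either all segment
dimensions are equal (required when `K > 2`) or `K = 2` (with `d_1, d_2` arbitrary), then the
minimal partition `J*` is the single element of `𝒥(K, d, dmin)`. -/
theorem jset_singleton_of_equal_dims [Fintype ι] [DecidableEq ι]
    (x : ι → EuclideanSpace ℝ (Fin m)) {K : ℕ} (P : Fin K → Finset ι)
    (hmss : IsMSSnp x P) (hni : NonIntersect x P) (hnd : IntNondeg x P)
    (d dmin d0 : ℕ)
    (hd : d = ∑ k, rOf x (P k))
    (hdmin : IsLeast (Set.range fun k => rOf x (P k)) dmin)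
    (hd0 : IsGreatest (Set.range fun k =>
      Module.finrank ℝ ↥(spanOf x (P k) ⊓ ⨆ (j) (_ : j ≠ k), spanOf x (P j))) d0)
    (h3 : ∀ k, rOf x (P k) + (K - 1) * d0 < (P k).card)
    (hdims : K = 2 ∨ ∀ k ℓ : Fin K, rOf x (P k) = rOf x (P ℓ)) :
    InJSet x K d dmin P ∧
      ∀ Q : Fin K → Finset ι, InJSet x K d dmin Q →
        ∃ e : Fin K ≃ Fin K, ∀ k, Q (e k) = P k := by
  subst hd
  obtain ⟨⟨k₀, hk₀⟩, hmin⟩ := hdmin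
  dsimp only at hk₀
  refine ⟨⟨hmss.cover, hmss.disj, fun k => ?_, le_rfl⟩, fun Q hQ => ?_⟩
  · exact (hmin ⟨k, rfl⟩).trans_lt (hmss.minimal k).1
  · rcases hdims with rfl | hdims
    · exact exists_equiv_of_two hmss hni hnd ⟨k₀, hk₀.le⟩ hQ
    · exact exists_equiv_of_rOf_eq hmss hni hnd (fun k => (hdims k k₀).trans hk₀) hQ
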